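/- arXiv:2303.05945 — 2 statements merged into one kernel-verified Lean document; each statement's English description precedes it below -/
import Mathlib

section
/- The derivative G' of the function G is Lipschitz continuous on ℝ. -/
open Filter Set

/-- The bump function `φ(u) = (1+u)³(1−u)³` for `|u| ≤ 1` and `φ(u) = 0` otherwise. -/
noncomputable def phi (u : ℝ) : ℝ := if |u| ≤ 1 then (1 + u) ^ 3 * (1 - u) ^ 3 else 0

/-- The transformation `G(x) = x + Σ_{j=1}^k α_j φ((x−ζ_j)/c)(x−ζ_j)|x−ζ_j|`. -/
noncomputable def Gfun (k : ℕ) (ζ α : Fin k → ℝ) (c : ℝ) (x : ℝ) : ℝ :=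
  x + ∑ j : Fin k, α j * (phi ((x - ζ j) / c) * ((x - ζ j) * |x - ζ j|))

theorem hasDerivAt_mul_abs_self (y : ℝ) : HasDerivAt (fun y : ℝ => y * |y|) (2 * |y|) y := by
  rcases lt_trichotomy y 0 with h | rfl | h
  · refine ((hasDerivAt_id' y).mul (hasDerivAt_abs_neg h)).congr_deriv ?_
    rw [abs_of_neg h]
    ring
  · rw [hasDerivAt_iff_tendsto_slope_zero]
    have hlim : Tendsto (fun t : ℝ => |t|) (nhdsWithin 0 {0}ᶜ) (nhds (2 * |(0 : ℝ)|)) := by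
      have := (continuous_abs (G := ℝ)).tendsto 0
      simp only [abs_zero, mul_zero] at this ⊢
      exact this.mono_left nhdsWithin_le_nhds
    refine hlim.congr' ?_
    filter_upwards [self_mem_nhdsWithin] with t ht
    have ht' : t ≠ 0 := ht
    simp [ht']
  · refine ((hasDerivAt_id' y).mul (hasDerivAt_abs_pos h)).congr_deriv ?_
    rw [abs_of_pos h]
    ring

theorem phi_eq_abs (u : ℝ) :
    phi u = ((1 - u ^ 2) ^ 3 + (1 - u ^ 2) * ((1 - u ^ 2) * |1 - u ^ 2|)) / 2 := by
  unfold phi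
  split_ifs with h
  · rw [abs_of_nonneg (by nlinarith [abs_le.1 h])]
    ring
  · rw [abs_of_nonpos]
    · ring
    · nlinarith [sq_abs u]

/-- The derivative of `φ(u) u |u|`, written on `[-1, 1]` as a polynomial times `|u|`. -/
noncomputable def bumpDeriv (w : ℝ) : ℝ :=
  |w| * (2 - 12 * w ^ 2 + 18 * (w ^ 2) ^ 2 - 8 * (w ^ 2) ^ 3)

theorem bumpDeriv_lipschitz_bound {a b : ℝ} (ha : |a| ≤ 1) (hb : |b| ≤ 1) :
    |bumpDeriv a - bumpDeriv b| ≤ 112 * |a - b| := by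
  have hs : a ^ 2 ≤ 1 := by nlinarith [sq_abs a, abs_nonneg a]
  have ht : b ^ 2 ≤ 1 := by nlinarith [sq_abs b, abs_nonneg b]
  have hs0 := sq_nonneg a
  have ht0 := sq_nonneg b
  have hsum : |a + b| ≤ 2 := (abs_add_le a b).trans (by linarith)
  have hab : |(|a| - |b|)| ≤ |a - b| := abs_abs_sub_abs_le_abs_sub a b
  have hst : |a ^ 2 - b ^ 2| ≤ 2 * |a - b| := by
    rw [show a ^ 2 - b ^ 2 = (a + b) * (a - b) by ring, abs_mul]
    gcongr
  unfold bumpDeriv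
  generalize a ^ 2 = s at *
  generalize b ^ 2 = t at *
  have hs2 : s ^ 2 ≤ 1 := pow_le_one₀ hs0 hs
  have hs3 : s ^ 3 ≤ 1 := pow_le_one₀ hs0 hs
  have ht2 : t ^ 2 ≤ 1 := pow_le_one₀ ht0 ht
  have hst1 : s * t ≤ 1 := mul_le_one₀ hs ht0 ht
  have hst0 : 0 ≤ s * t := mul_nonneg hs0 ht0
  have hr : |2 - 12 * s + 18 * s ^ 2 - 8 * s ^ 3| ≤ 40 := by
    rw [abs_le]
    constructor <;> nlinarith [sq_nonneg s, pow_nonneg hs0 3]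
  have hq : |-12 + 18 * (s + t) - 8 * (s ^ 2 + s * t + t ^ 2)| ≤ 36 := by
    rw [abs_le]
    constructor <;> nlinarith [sq_nonneg s, sq_nonneg t]
  calc _ = |(|a| - |b|) * (2 - 12 * s + 18 * s ^ 2 - 8 * s ^ 3)
        + |b| * ((s - t) * (-12 + 18 * (s + t) - 8 * (s ^ 2 + s * t + t ^ 2)))| := by
        congr 1
        ring
    _ ≤ |a - b| * 40 + 1 * (2 * |a - b| * 36) := by
        refine (abs_add_le _ _).trans ?_
        simp only [abs_mul, abs_abs]
        gcongr
    _ = 112 * |a - b| := by ring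

/-- The projection of the real line onto `[-1, 1]`. -/
noncomputable def clamp (u : ℝ) : ℝ := max (-1) (min 1 u)

theorem abs_clamp_le_one (u : ℝ) : |clamp u| ≤ 1 :=
  abs_le.2 ⟨le_max_left _ _, max_le (by norm_num) (min_le_left _ _)⟩

theorem abs_clamp_sub_clamp_le (u v : ℝ) : |clamp u - clamp v| ≤ |u - v| := by
  unfold clamp
  refine (abs_max_sub_max_le_max _ _ _ _).trans ?_
  rw [sub_self, abs_zero, max_eq_right (abs_nonneg _)]
  refine (abs_min_sub_min_le_max _ _ _ _).trans ?_
  rw [sub_self, abs_zero, max_eq_right (abs_nonneg _)]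

theorem hasDerivAt_phi_mul (u : ℝ) :
    HasDerivAt (fun u => phi u * (u * |u|)) (bumpDeriv (clamp u)) u := by
  have hY : HasDerivAt (fun u : ℝ => 1 - u ^ 2) (-(2 * u)) u := by
    simpa using (hasDerivAt_pow 2 u).const_sub 1
  have hphi := (((hY.pow 3).add
    (hY.mul ((hasDerivAt_mul_abs_self (1 - u ^ 2)).comp u hY))).div_const 2).mul
      (hasDerivAt_mul_abs_self u)
  refine (hphi.congr_of_eventuallyEq
    (Eventually.of_forall fun x => ?_)).congr_deriv ?_
  · simp [phi_eq_abs]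
  · simp only [Function.comp_apply, Pi.add_apply, Pi.mul_apply, Pi.pow_apply, bumpDeriv]
    rcases le_total |u| 1 with h | h
    · have hcl : clamp u = u := by
        obtain ⟨h1, h2⟩ := abs_le.1 h
        simp [clamp, h1, h2]
      rw [hcl, abs_of_nonneg (a := 1 - u ^ 2) (by nlinarith [sq_abs u, abs_nonneg u])]
      push_cast
      ring
    · have hcl : clamp u ^ 2 = 1 ∧ |clamp u| = 1 := by
        rcases le_abs.1 h with h | h
        · simp [clamp, h]
        · have : clamp u = -1 := max_eq_left ((min_le_right _ _).trans (by linarith))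
          simp [this]
      rw [hcl.1, hcl.2, abs_of_nonpos (a := 1 - u ^ 2) (by nlinarith [sq_abs u])]
      push_cast
      ring

theorem hasDerivAt_Gfun (k : ℕ) (ζ α : Fin k → ℝ) {c : ℝ} (hc : 0 < c) (x : ℝ) :
    HasDerivAt (Gfun k ζ α c)
      (1 + ∑ j : Fin k, α j * (c * bumpDeriv (clamp ((x - ζ j) / c)))) x := by
  unfold Gfun
  refine (hasDerivAt_id' x).add (HasDerivAt.fun_sum fun j _ => HasDerivAt.const_mul _ ?_)
  have hlin : HasDerivAt (fun x => (x - ζ j) / c) (1 / c) x :=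
    ((hasDerivAt_id' x).sub_const _).div_const c
  refine ((((hasDerivAt_phi_mul ((x - ζ j) / c)).comp x hlin).const_mul
    (c ^ 2)).congr_of_eventuallyEq (Eventually.of_forall fun y => ?_)).congr_deriv ?_
  · simp only [Function.comp_apply, abs_div, abs_of_pos hc]
    field_simp
  · field_simp

/-- The derivative `G'` of `G` is Lipschitz continuous on `ℝ`. -/
theorem stmt12 (k : ℕ) (ζ α : Fin k → ℝ) (hζ : StrictMono ζ) (c : ℝ) (hc : 0 < c)
    (hα : ∀ j : Fin k, α j ≠ 0 → c < 1 / (6 * |α j|))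
    (hsep : ∀ (j : ℕ) (h : j + 1 < k), c < (ζ ⟨j + 1, h⟩ - ζ ⟨j, by omega⟩) / 2) :
    ∃ K : NNReal, LipschitzWith K (deriv (Gfun k ζ α c)) := by
  refine ⟨Real.toNNReal (∑ j : Fin k, |α j| * 112), LipschitzWith.of_dist_le' fun x y => ?_⟩
  rw [(hasDerivAt_Gfun k ζ α hc x).deriv, (hasDerivAt_Gfun k ζ α hc y).deriv, Real.dist_eq,
    Real.dist_eq, add_sub_add_left_eq_sub, ← Finset.sum_sub_distrib, Finset.sum_mul]
  refine (Finset.abs_sum_le_sum_abs _ _).trans (Finset.sum_le_sum fun j _ => ?_)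
  rw [← mul_sub, ← mul_sub, abs_mul, abs_mul, abs_of_pos hc, mul_assoc]
  refine mul_le_mul_of_nonneg_left ?_ (abs_nonneg _)
  calc c * |bumpDeriv (clamp ((x - ζ j) / c)) - bumpDeriv (clamp ((y - ζ j) / c))|
      ≤ c * (112 * |(x - ζ j) / c - (y - ζ j) / c|) := by
        refine mul_le_mul_of_nonneg_left ?_ hc.le
        refine (bumpDeriv_lipschitz_bound (abs_clamp_le_one _) (abs_clamp_le_one _)).trans ?_
        exact mul_le_mul_of_nonneg_left (abs_clamp_sub_clamp_le _ _) (by norm_num)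
    _ = 112 * |x - y| := by
        rw [← sub_div, sub_sub_sub_cancel_right, abs_div, abs_of_pos hc]
        field_simp
end

section
/- The function G is twice differentiable at every x ∉ {ζ_1,…,ζ_k}, and there exists a Lipschitz continuous function f: ℝ → ℝ such that f(x) = G'(x)·μ(x) + (1/2)·G''(x) for every x ∉ {ζ_1,…,ζ_k}; i.e., the transformed drift x ↦ G'(x)μ(x) + (1/2)G''(x) extends from ℝ \ {ζ_1,…,ζ_k} to a Lipschitz continuous function on ℝ. -/
open Filter Set

/-- For `i ∈ {0,…,k}`, the open interval `(ζ_i, ζ_{i+1})` (with the conventions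
`ζ_0 = −∞` and `ζ_{k+1} = ∞`), where `ζ_1, …, ζ_k` are given by `ζ : Fin k → ℝ`. -/
def piece (k : ℕ) (ζ : Fin k → ℝ) (i : Fin (k + 1)) : Set ℝ :=
  {x : ℝ | (∀ _ : 0 < i.val, ζ ⟨i.val - 1, by have := i.isLt; omega⟩ < x) ∧
           (∀ h : i.val < k, x < ζ ⟨i.val, h⟩)}

/-- `f` satisfies a Lipschitz bound on all pairs of points related by `r`. -/
def LipOnPairs (r : ℝ → ℝ → Prop) (f : ℝ → ℝ) : Prop :=
  ∃ C : ℝ, 0 ≤ C ∧ ∀ a b, r a b → |f a - f b| ≤ C * |a - b|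

namespace LipOnPairs

variable {r : ℝ → ℝ → Prop} {f g : ℝ → ℝ}

lemma add (hf : LipOnPairs r f) (hg : LipOnPairs r g) : LipOnPairs r (fun x => f x + g x) := by
  obtain ⟨C, hC, hf⟩ := hf
  obtain ⟨D, hD, hg⟩ := hg
  refine ⟨C + D, by positivity, fun a b hab => ?_⟩
  have : f a + g a - (f b + g b) = (f a - f b) + (g a - g b) := by ring
  rw [this, add_mul]
  exact (abs_add_le _ _).trans (add_le_add (hf a b hab) (hg a b hab))

lemma const_mul (t : ℝ) (hf : LipOnPairs r f) : LipOnPairs r (fun x => t * f x) := by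
  obtain ⟨C, hC, hf⟩ := hf
  refine ⟨|t| * C, by positivity, fun a b hab => ?_⟩
  rw [← mul_sub, abs_mul, mul_assoc]
  exact mul_le_mul_of_nonneg_left (hf a b hab) (abs_nonneg t)

lemma sum {ι : Type*} (s : Finset ι) {f : ι → ℝ → ℝ} (hf : ∀ i ∈ s, LipOnPairs r (f i)) :
    LipOnPairs r (fun x => ∑ i ∈ s, f i x) := by
  classical
  induction s using Finset.induction_on with
  | empty => exact ⟨0, le_rfl, fun a b _ => by simp⟩
  | insert i s his ih =>
    simp only [Finset.sum_insert his]
    exact (hf i (Finset.mem_insert_self i s)).add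
      (ih fun j hj => hf j (Finset.mem_insert_of_mem hj))

lemma of_cover {n : ℕ} {s : Fin n → Set ℝ}
    (hf : ∀ i, LipOnPairs (fun a b => a ∈ s i ∧ b ∈ s i) f)
    (hr : ∀ a b, r a b → ∃ i, a ∈ s i ∧ b ∈ s i) : LipOnPairs r f := by
  choose C hC hf using hf
  refine ⟨∑ i, C i, Finset.sum_nonneg fun i _ => hC i, fun a b hab => ?_⟩
  obtain ⟨i, hi⟩ := hr a b hab
  refine (hf i a b hi).trans (mul_le_mul_of_nonneg_right ?_ (abs_nonneg _))
  exact Finset.single_le_sum (fun i _ => hC i) (Finset.mem_univ i)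

/-- The product of a compactly supported Lipschitz function with a function that is Lipschitz
on `s` is Lipschitz on `s`. -/
lemma mul_of_support {s : Set ℝ} {R : ℝ} (hR : 0 ≤ R)
    (hg : LipOnPairs (fun _ _ => True) g) (hgR : ∀ x, R < |x| → g x = 0)
    (hf : LipOnPairs (fun a b => a ∈ s ∧ b ∈ s) f) :
    LipOnPairs (fun a b => a ∈ s ∧ b ∈ s) (fun x => g x * f x) := by
  obtain ⟨L, hL, hg⟩ := hg
  obtain ⟨K, hK, hf⟩ := hf
  rcases s.eq_empty_or_nonempty with rfl | ⟨x₀, hx₀⟩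
  · exact ⟨0, le_rfl, fun a b h => absurd h.1 (Set.notMem_empty a)⟩
  have hB : ∀ x, |g x| ≤ L * (2 * R + 1) := by
    intro x
    by_cases hx : R < |x|
    · rw [hgR x hx, abs_zero]; positivity
    · have h1 := hg x (R + 1) trivial
      rw [hgR (R + 1) (by rw [abs_of_nonneg] <;> linarith), sub_zero] at h1
      refine h1.trans (mul_le_mul_of_nonneg_left ?_ hL)
      rw [abs_le]
      constructor <;> linarith [neg_abs_le x, le_abs_self x]
  have hM : ∀ x ∈ s, |x| ≤ R → |f x| ≤ |f x₀| + K * (R + |x₀|) := by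
    intro x hx hxR
    have h1 := hf x x₀ ⟨hx, hx₀⟩
    have h2 : |x - x₀| ≤ R + |x₀| := (abs_sub x x₀).trans (by linarith)
    have h3 := mul_le_mul_of_nonneg_left h2 hK
    linarith [abs_sub_abs_le_abs_sub (f x) (f x₀)]
  set M := |f x₀| + K * (R + |x₀|) with hMdef
  have hM0 : 0 ≤ M := by positivity
  have key : ∀ a b, a ∈ s → b ∈ s → |a| ≤ R →
      |g a * f a - g b * f b| ≤ (L * M + L * (2 * R + 1) * K) * |a - b| := by
    intro a b ha hb haR
    have e : g a * f a - g b * f b = (g a - g b) * f a + g b * (f a - f b) := by ring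
    rw [e]
    refine (abs_add_le _ _).trans ?_
    rw [abs_mul, abs_mul]
    have h1 := mul_le_mul (hg a b trivial) (hM a ha haR) (abs_nonneg _) (by positivity)
    have h2 := mul_le_mul (hB b) (hf a b ⟨ha, hb⟩) (abs_nonneg _) (by positivity)
    linarith
  refine ⟨L * M + L * (2 * R + 1) * K, by positivity, fun a b ⟨ha, hb⟩ => ?_⟩
  by_cases haR : |a| ≤ R
  · exact key a b ha hb haR
  by_cases hbR : |b| ≤ R
  · rw [abs_sub_comm, abs_sub_comm a b]
    exact key b a hb ha hbR
  · simp only [hgR a (not_le.1 haR), hgR b (not_le.1 hbR), zero_mul, sub_zero, abs_zero]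
    positivity

end LipOnPairs

/-- A function satisfying a Lipschitz bound on all intervals avoiding a finite set, and having
limits at the points of this set, agrees off this set with a Lipschitz function. -/
lemma exists_lipschitz_extension (K : ℝ) (S : Finset ℝ) (F : ℝ → ℝ)
    (hF : ∀ a b, a ≤ b → (∀ s ∈ S, s ∉ Icc a b) → |F a - F b| ≤ K * (b - a))
    (hlim : ∀ s ∈ S, ∃ l, Tendsto F (nhdsWithin s {s}ᶜ) (nhds l)) :
    ∃ f : ℝ → ℝ, (∀ a b, a ≤ b → |f a - f b| ≤ K * (b - a)) ∧ ∀ x ∉ S, f x = F x := by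
  classical
  induction S using Finset.induction_on generalizing F with
  | empty => exact ⟨F, fun a b hab => hF a b hab (by simp), fun _ _ => rfl⟩
  | insert s S hs ih =>
    obtain ⟨l, hl⟩ := hlim s (Finset.mem_insert_self s S)
    have hne : ∀ x, x ≠ s → Function.update F s l x = F x :=
      fun x hx => Function.update_of_ne hx _ _
    have left : ∀ a, a ≤ s → (∀ t ∈ S, t ∉ Icc a s) →
        |Function.update F s l a - l| ≤ K * (s - a) := by
      intro a has hav
      rcases has.eq_or_lt with rfl | has
      · simp
      rw [hne a has.ne]
      have h1 : Tendsto (fun t => |F a - F t|) (nhdsWithin s (Iio s)) (nhds |F a - l|) :=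
        (tendsto_const_nhds.sub (hl.mono_left (nhdsWithin_mono _ fun x hx => ne_of_lt hx))).abs
      have h2 : Tendsto (fun t => K * (t - a)) (nhdsWithin s (Iio s)) (nhds (K * (s - a))) :=
        (Continuous.tendsto (by fun_prop) s).mono_left nhdsWithin_le_nhds
      refine le_of_tendsto_of_tendsto h1 h2 ?_
      filter_upwards [Ioo_mem_nhdsLT has] with t ht
      refine hF a t ht.1.le fun u hu hut => ?_
      rcases Finset.mem_insert.1 hu with rfl | hu
      · exact absurd hut.2 (not_le.2 ht.2)
      · exact hav u hu ⟨hut.1, hut.2.trans ht.2.le⟩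
    have right : ∀ b, s ≤ b → (∀ t ∈ S, t ∉ Icc s b) →
        |l - Function.update F s l b| ≤ K * (b - s) := by
      intro b hsb hav
      rcases hsb.eq_or_lt with rfl | hsb
      · simp
      rw [hne b hsb.ne']
      have h1 : Tendsto (fun t => |F t - F b|) (nhdsWithin s (Ioi s)) (nhds |l - F b|) :=
        ((hl.mono_left (nhdsWithin_mono _ fun x hx => ne_of_gt hx)).sub tendsto_const_nhds).abs
      have h2 : Tendsto (fun t => K * (b - t)) (nhdsWithin s (Ioi s)) (nhds (K * (b - s))) :=
        (Continuous.tendsto (by fun_prop) s).mono_left nhdsWithin_le_nhds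
      refine le_of_tendsto_of_tendsto h1 h2 ?_
      filter_upwards [Ioo_mem_nhdsGT hsb] with t ht
      refine hF t b ht.2.le fun u hu hut => ?_
      rcases Finset.mem_insert.1 hu with rfl | hu
      · exact absurd hut.1 (not_le.2 ht.1)
      · exact hav u hu ⟨ht.1.le.trans hut.1, hut.2⟩
    obtain ⟨f, hf, hfF⟩ := ih (Function.update F s l) (by
      intro a b hab hav
      by_cases hsab : s ∈ Icc a b
      · have h1 := left a hsab.1 fun t ht h => hav t ht ⟨h.1, h.2.trans hsab.2⟩
        have h2 := right b hsab.2 fun t ht h => hav t ht ⟨hsab.1.trans h.1, h.2⟩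
        have h3 := abs_sub_le (Function.update F s l a) l (Function.update F s l b)
        linarith
      · rw [hne a (by rintro rfl; exact hsab ⟨le_rfl, hab⟩),
          hne b (by rintro rfl; exact hsab ⟨hab, le_rfl⟩)]
        refine hF a b hab fun t ht => ?_
        rcases Finset.mem_insert.1 ht with rfl | ht
        · exact hsab
        · exact hav t ht) (by
      intro t ht
      obtain ⟨l', hl'⟩ := hlim t (Finset.mem_insert_of_mem ht)
      have hts : t ≠ s := by rintro rfl; exact hs ht
      refine ⟨l', hl'.congr' ?_⟩
      filter_upwards [nhdsWithin_le_nhds (isOpen_ne.mem_nhds hts)] with x hx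
      exact (hne x hx).symm)
    refine ⟨f, hf, fun x hx => ?_⟩
    rw [Finset.mem_insert, not_or] at hx
    rw [hfF x hx.2, hne x hx.1]

lemma hasDerivAt_posPart_pow (n : ℕ) (t : ℝ) :
    HasDerivAt (fun t : ℝ => (max 0 t) ^ (n + 2)) ((n + 2) * (max 0 t) ^ (n + 1)) t := by
  have hpow : HasDerivAt (fun t : ℝ => t ^ (n + 2)) ((n + 2) * t ^ (n + 1)) t := by
    simpa using hasDerivAt_pow (n + 2) t
  rcases lt_trichotomy t 0 with ht | rfl | ht
  · rw [max_eq_left ht.le]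
    have h : HasDerivAt (fun _ : ℝ => (0 : ℝ)) 0 t := hasDerivAt_const t 0
    simp only [ne_eq, Nat.add_eq_zero_iff, one_ne_zero, and_false, not_false_eq_true, zero_pow,
      mul_zero]
    refine h.congr_of_eventuallyEq ?_
    filter_upwards [Iio_mem_nhds ht] with x hx
    simp [max_eq_left (le_of_lt (mem_Iio.1 hx))]
  · have h1 : HasDerivWithinAt (fun t : ℝ => (max 0 t) ^ (n + 2))
        ((n + 2) * (max 0 0) ^ (n + 1)) (Ici 0) (0 : ℝ) := by
      rw [max_self]
      exact hpow.hasDerivWithinAt.congr (fun x hx => by rw [max_eq_right hx]) (by simp)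
    have h2 : HasDerivWithinAt (fun t : ℝ => (max 0 t) ^ (n + 2))
        ((n + 2) * (max 0 0) ^ (n + 1)) (Iic 0) (0 : ℝ) := by
      have h : HasDerivWithinAt (fun _ : ℝ => (0 : ℝ)) 0 (Iic 0) 0 :=
        hasDerivWithinAt_const 0 _ 0
      simp only [max_self, ne_eq, Nat.add_eq_zero_iff, one_ne_zero, and_false,
        not_false_eq_true, zero_pow, mul_zero]
      exact h.congr (fun x hx => by simp [max_eq_left (mem_Iic.1 hx)]) (by simp)
    have h3 := h1.union h2
    rwa [Ici_union_Iic, hasDerivWithinAt_univ] at h3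
  · rw [max_eq_right ht.le]
    refine hpow.congr_of_eventuallyEq ?_
    filter_upwards [Ioi_mem_nhds ht] with x hx
    rw [max_eq_right (le_of_lt hx)]

lemma hasDerivAt_mul_abs (u : ℝ) : HasDerivAt (fun u : ℝ => u * |u|) (2 * |u|) u := by
  have h1 := hasDerivAt_posPart_pow 0 u
  have h2 := (hasDerivAt_posPart_pow 0 (-u)).comp u (hasDerivAt_neg u)
  refine ((h1.sub h2).congr_of_eventuallyEq (.of_forall fun x => ?_)).congr_deriv ?_
  · rcases le_total 0 x with hx | hx
    · simp [abs_of_nonneg hx, max_eq_right hx, max_eq_left (neg_nonpos.2 hx)]; ring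
    · simp [abs_of_nonpos hx, max_eq_left hx, max_eq_right (neg_nonneg.2 hx)]; ring
  · rcases le_total 0 u with hx | hx
    · simp [abs_of_nonneg hx, max_eq_right hx, max_eq_left (neg_nonpos.2 hx)]
    · simp [abs_of_nonpos hx, max_eq_left hx, max_eq_right (neg_nonneg.2 hx)]

lemma phi_eq (u : ℝ) : phi u = (max 0 (1 - u ^ 2)) ^ 3 := by
  unfold phi
  split_ifs with h
  · rw [max_eq_right (by nlinarith [sq_abs u, abs_nonneg u])]; ring
  · rw [max_eq_left (by nlinarith [sq_abs u, abs_nonneg u])]; simp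

/-- In terms of `p = min |u| 1`, the first derivative of `φ(u) u |u|`. -/
noncomputable def bumpDerivPoly (p : ℝ) : ℝ :=
  p * (8 * (1 - p ^ 2) ^ 3 - 6 * (1 - p ^ 2) ^ 2)

/-- In terms of `p = min |u| 1`, the second derivative of `φ(u) u |u|` up to the sign of `u`. -/
noncomputable def bumpSecondDerivPoly (p : ℝ) : ℝ :=
  56 * (1 - p ^ 2) ^ 3 - 78 * (1 - p ^ 2) ^ 2 + 24 * (1 - p ^ 2)

lemma bumpDerivPoly_min (u : ℝ) : bumpDerivPoly (min |u| 1) =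
    |u| * (8 * (max 0 (1 - u ^ 2)) ^ 3 - 6 * (max 0 (1 - u ^ 2)) ^ 2) := by
  unfold bumpDerivPoly
  rcases le_total |u| 1 with h | h
  · rw [min_eq_left h, max_eq_right (by nlinarith [sq_abs u, abs_nonneg u]), sq_abs]
  · rw [min_eq_right h, max_eq_left (by nlinarith [sq_abs u, abs_nonneg u])]; norm_num

lemma hasDerivAt_bump (u : ℝ) :
    HasDerivAt (fun u => phi u * (u * |u|)) (bumpDerivPoly (min |u| 1)) u := by
  have hq : HasDerivAt (fun u : ℝ => 1 - u ^ 2) (-(2 * u)) u := by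
    simpa using (hasDerivAt_pow 2 u).const_sub 1
  have h3 := (hasDerivAt_posPart_pow 1 (1 - u ^ 2)).comp u hq
  refine ((h3.mul (hasDerivAt_mul_abs u)).congr_of_eventuallyEq
    (.of_forall fun x => ?_)).congr_deriv ?_
  · simp [phi_eq]
  · rw [bumpDerivPoly_min]
    rcases le_total (1 - u ^ 2) 0 with h | h
    · simp [max_eq_left h]
    · simp [max_eq_right h]; ring

lemma hasDerivAt_bumpDeriv {u : ℝ} (hu : u ≠ 0) :
    HasDerivAt (fun u => bumpDerivPoly (min |u| 1))
      ((SignType.sign u : ℝ) * bumpSecondDerivPoly (min |u| 1)) u := by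
  have hq : HasDerivAt (fun u : ℝ => 1 - u ^ 2) (-(2 * u)) u := by
    simpa using (hasDerivAt_pow 2 u).const_sub 1
  have h3 := ((hasDerivAt_posPart_pow 1 (1 - u ^ 2)).comp u hq).const_mul 8
  have h2 := ((hasDerivAt_posPart_pow 0 (1 - u ^ 2)).comp u hq).const_mul 6
  refine (((hasDerivAt_abs hu).mul (h3.sub h2)).congr_of_eventuallyEq
    (.of_forall fun x => ?_)).congr_deriv ?_
  · simp [bumpDerivPoly_min]
  · unfold bumpSecondDerivPoly
    have hs : |u| = (SignType.sign u : ℝ) * u := (sign_mul_self u).symm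
    rcases le_total |u| 1 with h | h
    · rw [min_eq_left h, sq_abs]
      have h' : 0 ≤ 1 - u ^ 2 := by nlinarith [sq_abs u, abs_nonneg u]
      simp only [Pi.sub_apply, Function.comp, max_eq_right h', hs]
      push_cast
      ring
    · rw [min_eq_right h]
      have h' : 1 - u ^ 2 ≤ 0 := by nlinarith [sq_abs u, abs_nonneg u]
      simp [max_eq_left h']

lemma lipOnPairs_comp_min {Q : ℝ → ℝ} (hQ : ContDiff ℝ 1 Q) (z c : ℝ) :
    LipOnPairs (fun _ _ => True) (fun x => Q (min |(x - z) / c| 1)) := by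
  obtain ⟨K, hK⟩ := hQ.contDiffOn.exists_lipschitzOnWith (s := Icc (0 : ℝ) 1) one_ne_zero
    (convex_Icc 0 1) isCompact_Icc
  refine ⟨K * |c|⁻¹, by positivity, fun a b _ => ?_⟩
  have hmem : ∀ u : ℝ, min |u| 1 ∈ Icc (0 : ℝ) 1 :=
    fun u => ⟨le_min (abs_nonneg u) zero_le_one, min_le_right _ _⟩
  have h1 := hK.dist_le_mul _ (hmem ((a - z) / c)) _ (hmem ((b - z) / c))
  rw [Real.dist_eq, Real.dist_eq] at h1
  have h2 : |min |(a - z) / c| 1 - min |(b - z) / c| 1| ≤ |(a - z) / c - (b - z) / c| :=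
    (abs_min_sub_min_le_max _ _ _ _).trans
      (max_le (abs_abs_sub_abs_le _ _) (by simp))
  have h3 : |(a - z) / c - (b - z) / c| = |c|⁻¹ * |a - b| := by
    rw [← sub_div, abs_div, sub_sub_sub_cancel_right, div_eq_inv_mul]
  rw [h3] at h2
  calc _ ≤ _ := h1
    _ ≤ K * (|c|⁻¹ * |a - b|) := by gcongr
    _ = _ := by ring

lemma contDiff_bumpDerivPoly : ContDiff ℝ 1 bumpDerivPoly := by
  unfold bumpDerivPoly; fun_prop

lemma contDiff_bumpSecondDerivPoly : ContDiff ℝ 1 bumpSecondDerivPoly := by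
  unfold bumpSecondDerivPoly; fun_prop

lemma bumpDerivPoly_one : bumpDerivPoly 1 = 0 := by norm_num [bumpDerivPoly]

lemma bumpDerivPoly_zero : bumpDerivPoly 0 = 0 := by norm_num [bumpDerivPoly]

lemma bumpSecondDerivPoly_one : bumpSecondDerivPoly 1 = 0 := by norm_num [bumpSecondDerivPoly]

lemma bumpSecondDerivPoly_zero : bumpSecondDerivPoly 0 = 2 := by norm_num [bumpSecondDerivPoly]

lemma min_abs_div_eq_one {c t : ℝ} (hc : 0 < c) (h : c ≤ |t|) : min |t / c| 1 = 1 := by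
  rw [abs_div, abs_of_pos hc]
  exact min_eq_right ((one_le_div hc).2 h)

lemma sign_div_of_pos {c : ℝ} (hc : 0 < c) (t : ℝ) :
    SignType.sign (t / c) = SignType.sign t := by
  rw [div_eq_mul_inv, sign_mul, sign_pos (inv_pos.2 hc), mul_one]

/-- The explicit derivative of `Gfun`. -/
noncomputable def GfunDeriv (k : ℕ) (ζ α : Fin k → ℝ) (c : ℝ) (x : ℝ) : ℝ :=
  1 + ∑ j : Fin k, α j * c * bumpDerivPoly (min |(x - ζ j) / c| 1)

/-- The explicit second derivative of `Gfun` away from the points `ζ j`. -/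
noncomputable def GfunSecondDeriv (k : ℕ) (ζ α : Fin k → ℝ) (c : ℝ) (x : ℝ) : ℝ :=
  ∑ j : Fin k, α j * ((SignType.sign (x - ζ j) : ℝ) *
    bumpSecondDerivPoly (min |(x - ζ j) / c| 1))

section Transform

variable {k : ℕ} {ζ α : Fin k → ℝ} {c : ℝ}

lemma hasDerivAt_sub_div (z c x : ℝ) : HasDerivAt (fun x : ℝ => (x - z) / c) (1 / c) x :=
  ((hasDerivAt_id x).sub_const z).div_const c

lemma hasDerivAt_Gfun_s16 (hc : 0 < c) (x : ℝ) :
    HasDerivAt (Gfun k ζ α c) (GfunDeriv k ζ α c x) x := by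
  refine (hasDerivAt_id x).add (HasDerivAt.fun_sum fun j _ => ?_)
  have h := (((hasDerivAt_bump ((x - ζ j) / c)).comp x
    (hasDerivAt_sub_div (ζ j) c x)).const_mul (c ^ 2)).const_mul (α j)
  refine (h.congr_of_eventuallyEq (.of_forall fun y => ?_)).congr_deriv ?_
  · simp only [Function.comp, abs_div, abs_of_pos hc]
    field_simp
  · field_simp

lemma hasDerivAt_GfunDeriv (hc : 0 < c) {x : ℝ} (hx : ∀ j, x ≠ ζ j) :
    HasDerivAt (GfunDeriv k ζ α c) (GfunSecondDeriv k ζ α c x) x := by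
  refine (HasDerivAt.fun_sum fun j _ => ?_).const_add 1
  have hne : (x - ζ j) / c ≠ 0 := div_ne_zero (sub_ne_zero.2 (hx j)) hc.ne'
  have h := ((hasDerivAt_bumpDeriv hne).comp x (hasDerivAt_sub_div (ζ j) c x)).const_mul (α j * c)
  refine h.congr_deriv ?_
  rw [sign_div_of_pos hc]
  field_simp

lemma deriv_Gfun (hc : 0 < c) : deriv (Gfun k ζ α c) = GfunDeriv k ζ α c :=
  funext fun x => (hasDerivAt_Gfun_s16 hc x).deriv

lemma le_abs_sub_of_ne (hζ : StrictMono ζ) (hc : 0 < c)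
    (hsep : ∀ (j : ℕ) (h : j + 1 < k), c < (ζ ⟨j + 1, h⟩ - ζ ⟨j, Nat.lt_of_succ_lt h⟩) / 2)
    {i j : Fin k} (hij : i ≠ j) : c ≤ |ζ i - ζ j| := by
  have key : ∀ i j : Fin k, i < j → c ≤ ζ j - ζ i := by
    intro i j hij
    have hlt : i.val + 1 < k := by have := j.isLt; have : i.val < j.val := hij; omega
    have h1 := hsep i.val hlt
    have h2 : ζ ⟨i.val + 1, hlt⟩ ≤ ζ j := hζ.monotone (by
      rw [Fin.le_def]; exact Nat.succ_le_of_lt hij)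
    simp only [Fin.eta] at h1
    linarith
  rcases lt_or_gt_of_ne hij with h | h
  · rw [abs_sub_comm]; exact (key i j h).trans (le_abs_self _)
  · exact (key j i h).trans (le_abs_self _)

lemma exists_mem_piece {a b : ℝ} (hab : a ≤ b) (h : ∀ j, ζ j ∉ Icc a b) :
    ∃ i, a ∈ piece k ζ i ∧ b ∈ piece k ζ i := by
  classical
  have hex : ∃ n, ∀ h : n < k, a < ζ ⟨n, h⟩ := ⟨k, fun h => absurd h (lt_irrefl k)⟩
  set n := Nat.find hex with hn
  have hnk : n ≤ k := Nat.find_min' hex fun h => absurd h (lt_irrefl k)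
  have hspec : ∀ h : n < k, a < ζ ⟨n, h⟩ := Nat.find_spec hex
  have hlow : ∀ hpos : 0 < n, ζ ⟨n - 1, by omega⟩ < a := by
    intro hpos
    have h1 := Nat.find_min hex (m := n - 1) (by omega)
    push Not at h1
    obtain ⟨_, h2⟩ := h1
    exact lt_of_le_of_ne h2 fun he => h _ ⟨he.ge, he.le.trans hab⟩
  refine ⟨⟨n, by omega⟩, ⟨hlow, hspec⟩, fun hpos => (hlow hpos).trans_le hab, fun hlt => ?_⟩
  by_contra hle
  exact h ⟨n, hlt⟩ ⟨(hspec hlt).le, not_lt.1 hle⟩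

lemma tendsto_transformed_drift (hc : 0 < c) (hsep : ∀ i j, i ≠ j → c ≤ |ζ i - ζ j|)
    {μ : ℝ → ℝ} {j : Fin k} {l : Filter ℝ} (hl : l ≤ nhds (ζ j)) {σ : SignType}
    (hσ : ∀ᶠ x in l, SignType.sign (x - ζ j) = σ) {v : ℝ} (hv : Tendsto μ l (nhds v)) :
    Tendsto (fun x => GfunDeriv k ζ α c x * μ x + (1 / 2) * GfunSecondDeriv k ζ α c x) l
      (nhds (v + (σ : ℝ) * α j)) := by
  have hcont : ∀ {Q : ℝ → ℝ}, ContDiff ℝ 1 Q → ∀ i, Tendsto (fun x => Q (min |(x - ζ i) / c| 1)) l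
      (nhds (Q (min |(ζ j - ζ i) / c| 1))) := by
    intro Q hQ i
    have := hQ.continuous
    exact (Continuous.tendsto (f := fun x => Q (min |(x - ζ i) / c| 1)) (by fun_prop) _).mono_left hl
  have hfar : ∀ i, i ≠ j → min |(ζ j - ζ i) / c| 1 = 1 :=
    fun i hi => min_abs_div_eq_one hc (hsep j i hi.symm)
  have h1 : Tendsto (GfunDeriv k ζ α c) l (nhds 1) := by
    have : Tendsto (GfunDeriv k ζ α c) l (nhds (1 + ∑ i : Fin k, 0)) := by
      refine tendsto_const_nhds.add (tendsto_finsetSum _ fun i _ => ?_)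
      have h := (hcont contDiff_bumpDerivPoly i).const_mul (α i * c)
      by_cases hi : i = j
      · subst hi
        simpa [bumpDerivPoly_zero] using h
      · simpa only [hfar i hi, bumpDerivPoly_one, mul_zero] using h
    simpa using this
  have h2 : Tendsto (GfunSecondDeriv k ζ α c) l (nhds (α j * ((σ : ℝ) * 2))) := by
    have : Tendsto (GfunSecondDeriv k ζ α c) l
        (nhds (∑ i : Fin k, if i = j then α j * ((σ : ℝ) * 2) else 0)) := by
      refine tendsto_finsetSum _ fun i _ => ?_
      have h := hcont contDiff_bumpSecondDerivPoly i
      split_ifs with hi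
      · subst hi
        have h' : Tendsto (fun x => α i * ((σ : ℝ) * bumpSecondDerivPoly (min |(x - ζ i) / c| 1))) l
            (nhds (α i * ((σ : ℝ) * 2))) := by
          simpa [bumpSecondDerivPoly_zero] using (h.const_mul (σ : ℝ)).const_mul (α i)
        refine h'.congr' ?_
        filter_upwards [hσ] with x hx
        rw [hx]
      · rw [hfar i hi, bumpSecondDerivPoly_one] at h
        have hb : ∀ x : ℝ, |(SignType.sign (x - ζ i) : ℝ)| ≤ 1 := by
          intro x
          rcases SignType.sign (x - ζ i) with _ | _ | _ <;> simp
        have h' := bdd_le_mul_tendsto_zero' 1 (.of_forall hb) h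
        simpa using h'.const_mul (α i)
    simpa using this
  have h3 := (h1.mul hv).add (h2.const_mul (1 / 2))
  convert h3 using 2
  ring

end Transform

/-- `G` is twice differentiable at every `x ∉ {ζ_1,…,ζ_k}`, and the transformed drift
`x ↦ G'(x)μ(x) + (1/2)G''(x)` extends from `ℝ \ {ζ_1,…,ζ_k}` to a Lipschitz continuous
function on `ℝ`. Here `μ` is piecewise Lipschitz with the `ζ_j` as the only possible
discontinuities, differentiable with Lipschitz derivative on each piece, with one-sided
limits `μ(ζ_j−)`, `μ(ζ_j+)` at each `ζ_j`, and `α_j = (μ(ζ_j−) − μ(ζ_j+))/2`. -/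
theorem stmt16 (μ : ℝ → ℝ) (k : ℕ) (ζ : Fin k → ℝ) (hζ : StrictMono ζ)
    (hLip : ∀ i : Fin (k + 1), ∃ K : NNReal, LipschitzOnWith K μ (piece k ζ i))
    (hdiff : ∀ i : Fin (k + 1), ∀ x ∈ piece k ζ i, DifferentiableAt ℝ μ x)
    (hdLip : ∀ i : Fin (k + 1), ∃ K : NNReal, LipschitzOnWith K (deriv μ) (piece k ζ i))
    (μp μm : Fin k → ℝ)
    (hμp : ∀ j : Fin k, Tendsto μ (nhdsWithin (ζ j) (Ioi (ζ j))) (nhds (μp j)))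
    (hμm : ∀ j : Fin k, Tendsto μ (nhdsWithin (ζ j) (Iio (ζ j))) (nhds (μm j)))
    (α : Fin k → ℝ) (hαdef : ∀ j : Fin k, α j = (μm j - μp j) / 2)
    (c : ℝ) (hc : 0 < c)
    (hα : ∀ j : Fin k, α j ≠ 0 → c < 1 / (6 * |α j|))
    (hsep : ∀ (j : ℕ) (h : j + 1 < k), c < (ζ ⟨j + 1, h⟩ - ζ ⟨j, by omega⟩) / 2) :
    (∀ x : ℝ, (∀ j : Fin k, x ≠ ζ j) →
        DifferentiableAt ℝ (Gfun k ζ α c) x ∧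
          DifferentiableAt ℝ (deriv (Gfun k ζ α c)) x) ∧
      ∃ f : ℝ → ℝ, (∃ K : NNReal, LipschitzWith K f) ∧
        ∀ x : ℝ, (∀ j : Fin k, x ≠ ζ j) →
          f x = deriv (Gfun k ζ α c) x * μ x
              + (1 / 2) * deriv (deriv (Gfun k ζ α c)) x := by
  have hsep' : ∀ i j, i ≠ j → c ≤ |ζ i - ζ j| := fun i j hij => le_abs_sub_of_ne hζ hc hsep hij
  rw [deriv_Gfun hc]
  refine ⟨fun x hx => ⟨(hasDerivAt_Gfun_s16 hc x).differentiableAt,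
    (hasDerivAt_GfunDeriv hc hx).differentiableAt⟩, ?_⟩
  let r : ℝ → ℝ → Prop := fun a b => a ≤ b ∧ ∀ j, ζ j ∉ Icc a b
  have hcover : ∀ a b, r a b → ∃ i, a ∈ piece k ζ i ∧ b ∈ piece k ζ i :=
    fun a b h => exists_mem_piece h.1 h.2
  have hμpiece : ∀ i, LipOnPairs (fun a b => a ∈ piece k ζ i ∧ b ∈ piece k ζ i) μ := by
    intro i
    obtain ⟨K, hK⟩ := hLip i
    refine ⟨K, K.coe_nonneg, fun a b h => ?_⟩
    simpa [Real.dist_eq] using hK.dist_le_mul a h.1 b h.2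
  have hprod : ∀ j, LipOnPairs r
      (fun x => bumpDerivPoly (min |(x - ζ j) / c| 1) * μ x) := by
    refine fun j => LipOnPairs.of_cover (fun i => ?_) hcover
    refine LipOnPairs.mul_of_support (R := |ζ j| + c) (by positivity)
      (lipOnPairs_comp_min contDiff_bumpDerivPoly (ζ j) c) (fun x hx => ?_) (hμpiece i)
    rw [min_abs_div_eq_one hc, bumpDerivPoly_one]
    linarith [abs_sub_abs_le_abs_sub x (ζ j)]
  have hsecond : ∀ j, LipOnPairs r (fun x => (SignType.sign (x - ζ j) : ℝ) *
      bumpSecondDerivPoly (min |(x - ζ j) / c| 1)) := by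
    intro j
    obtain ⟨L, hL, h⟩ := lipOnPairs_comp_min contDiff_bumpSecondDerivPoly (ζ j) c
    refine ⟨L, hL, fun a b hab => ?_⟩
    have hsign : SignType.sign (a - ζ j) = SignType.sign (b - ζ j) := by
      rcases lt_or_ge (ζ j) a with h1 | h1
      · rw [sign_pos (sub_pos.2 h1), sign_pos (sub_pos.2 (h1.trans_le hab.1))]
      · have h2 : b < ζ j := not_le.1 fun h2 => hab.2 j ⟨h1, h2⟩
        rw [sign_neg (sub_neg.2 h2), sign_neg (sub_neg.2 (hab.1.trans_lt h2))]
    simp only [hsign]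
    rw [← mul_sub, abs_mul]
    have hb : |(SignType.sign (b - ζ j) : ℝ)| ≤ 1 := by
      rcases SignType.sign (b - ζ j) with _ | _ | _ <;> simp
    exact (mul_le_of_le_one_left (abs_nonneg _) hb).trans (h a b trivial)
  have hF : LipOnPairs r
      (fun x => GfunDeriv k ζ α c x * μ x + (1 / 2) * GfunSecondDeriv k ζ α c x) := by
    have h := ((LipOnPairs.of_cover hμpiece hcover).add (LipOnPairs.sum Finset.univ
      fun j _ => (hprod j).const_mul (α j * c))).add ((LipOnPairs.sum Finset.univ
      fun j _ => (hsecond j).const_mul (α j)).const_mul (1 / 2))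
    convert h using 2 with x
    simp only [GfunDeriv, GfunSecondDeriv, add_mul, one_mul, Finset.sum_mul, mul_assoc]
  obtain ⟨K, hK, hF⟩ := hF
  obtain ⟨f, hf, hfF⟩ := exists_lipschitz_extension K (Finset.univ.image ζ) _
    (fun a b hab hav => by
      have h := hF a b ⟨hab, fun j => hav _ (Finset.mem_image_of_mem ζ (Finset.mem_univ j))⟩
      rwa [abs_sub_comm a b, abs_of_nonneg (sub_nonneg.2 hab)] at h)
    (fun s hs => by
      obtain ⟨j, -, rfl⟩ := Finset.mem_image.1 hs
      refine ⟨(μp j + μm j) / 2, ?_⟩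
      rw [← Iio_union_Ioi, nhdsWithin_union, tendsto_sup]
      constructor
      · convert tendsto_transformed_drift (α := α) (σ := -1) hc hsep' nhdsWithin_le_nhds ?_
          (hμm j) using 2
        · simp only [hαdef j, SignType.coe_neg, SignType.coe_one]; ring
        · filter_upwards [self_mem_nhdsWithin] with x hx
          exact sign_neg (sub_neg.2 hx)
      · convert tendsto_transformed_drift (α := α) (σ := 1) hc hsep' nhdsWithin_le_nhds ?_
          (hμp j) using 2
        · simp only [hαdef j, SignType.coe_one]; ring
        · filter_upwards [self_mem_nhdsWithin] with x hx
          exact sign_pos (sub_pos.2 hx))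
  refine ⟨f, ⟨K.toNNReal, LipschitzWith.of_dist_le_mul fun a b => ?_⟩, fun x hx => ?_⟩
  · rw [Real.coe_toNNReal K hK, Real.dist_eq, Real.dist_eq]
    rcases le_total a b with hab | hab
    · rw [abs_sub_comm a b, abs_of_nonneg (sub_nonneg.2 hab)]
      exact hf a b hab
    · rw [abs_sub_comm (f a), abs_of_nonneg (sub_nonneg.2 hab)]
      exact hf b a hab
  · rw [(hasDerivAt_GfunDeriv hc hx).deriv]
    refine hfF x fun h => ?_
    obtain ⟨j, -, hj⟩ := Finset.mem_image.1 h
    exact hx j hj.symm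
end
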